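/- For every integer T ≥ 1, C(T) − F(T)·G(T) = − ∑_{a/b ∈ 𝓕(T) ∩ [0,1/2]} ∑_{d=1}^{T} {d·a²/b²}·M(⌊T/d⌋), where the outer sum is over Farey fractions a/b ≤ 1/2 written in lowest terms, {α} denotes the fractional part of α, and M is the Mertens function. -/

import Mathlib

/-- The set of Farey fractions of order `T`: rationals `a/b` with
`0 ≤ a < b ≤ T` and `gcd(a,b) = 1`, viewed as a finite set of rationals in `[0,1)`. -/
def farey (T : ℕ) : Finset ℚ :=
  (((Finset.range (T + 1)) ×ˢ (Finset.range (T + 1))).filter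
    (fun p => p.1 < p.2 ∧ Nat.gcd p.1 p.2 = 1)).image (fun p => (p.1 : ℚ) / (p.2 : ℚ))

/-- `F(T)` is the number of Farey fractions of order `T`. -/
def F (T : ℕ) : ℕ := (farey T).card

/-- The Farey fractions of order `T` lying in `[0, 1/2]`. -/
def fareyHalf (T : ℕ) : Finset ℚ := (farey T).filter (fun q => q ≤ 1 / 2)

/-- `C(T) = ∑_{a/b ∈ 𝓕(T) ∩ [0,1/2]} #(𝓕(T) ∩ [1 - a²/b², 1])`, where a Farey fraction
`q = a/b` in lowest terms satisfies `a²/b² = q²`. -/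
def C (T : ℕ) : ℕ :=
  ∑ q ∈ fareyHalf T, ((farey T).filter (fun ξ => 1 - q ^ 2 ≤ ξ ∧ ξ ≤ 1)).card

/-- `G(T) = ∑_{ξ ∈ 𝓕(T), ξ ≤ 1/2} ξ²`. -/
noncomputable def G (T : ℕ) : ℝ := ∑ q ∈ fareyHalf T, (q : ℝ) ^ 2

/-- The Mertens function `M(n) = ∑_{1 ≤ k ≤ n} μ(k)`. -/
def mertens (n : ℕ) : ℤ := ∑ k ∈ Finset.Icc 1 n, ArithmeticFunction.moebius k

lemma mem_farey_iff (T : ℕ) (q : ℚ) : q ∈ farey T ↔ 0 ≤ q ∧ q < 1 ∧ q.den ≤ T := by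
  unfold farey
  simp only [Finset.mem_image, Finset.mem_filter, Finset.mem_product, Finset.mem_range]
  constructor
  · rintro ⟨⟨a, b⟩, ⟨⟨ha, hb⟩, hab, hg⟩, rfl⟩
    simp only at *
    have hb0 : 0 < b := by omega
    have hbq : (0 : ℚ) < b := by exact_mod_cast hb0
    refine ⟨by positivity, ?_, ?_⟩
    · rw [div_lt_one hbq]
      exact_mod_cast hab
    · have h := Rat.den_div_eq_of_coprime (a := (a : ℤ)) (b := (b : ℤ)) (by exact_mod_cast hb0)
        (by simpa using hg)
      push_cast at h
      have h2 : ((a : ℚ) / b).den = b := by exact_mod_cast h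
      rw [h2]
      omega
  · rintro ⟨h0, h1, hd⟩
    have hn0 : 0 ≤ q.num := Rat.num_nonneg.mpr h0
    have hlt : q.num < q.den := Rat.num_lt_denom_iff.mpr h1
    refine ⟨(q.num.natAbs, q.den), ⟨⟨?_, ?_⟩, ?_, q.reduced⟩, ?_⟩
    · simp only; omega
    · simp only; omega
    · simp only; omega
    · simp only
      have : ((q.num.natAbs : ℕ) : ℚ) = (q.num : ℚ) := by
        have : ((q.num.natAbs : ℕ) : ℤ) = q.num := Int.natAbs_of_nonneg hn0
        rw [← Int.cast_natCast, this]
      rw [this]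
      exact Rat.num_div_den q

lemma sum_moebius_dvd (n : ℕ) :
    ∑ d ∈ n.divisors, ArithmeticFunction.moebius d = if n = 1 then 1 else 0 := by
  rw [← ArithmeticFunction.coe_mul_zeta_apply, ArithmeticFunction.moebius_mul_coe_zeta,
    ArithmeticFunction.one_apply]

/-- floor counting function as an arithmetic function. -/
def floorAF (y : ℚ) : ArithmeticFunction ℤ := ⟨fun n => ((⌊y * n⌋₊ : ℕ) : ℤ), by simp⟩

lemma card_coprime_eq (y : ℚ) (n : ℕ) (hn : n ≠ 0) :
    (((Finset.Ioc 0 ⌊y * n⌋₊).filter (fun c => Nat.Coprime n c)).card : ℤ)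
      = (floorAF y * ArithmeticFunction.moebius) n := by
  rw [Finset.card_filter]
  push_cast
  have h1 : ∀ c ∈ Finset.Ioc 0 ⌊y * n⌋₊, (if Nat.Coprime n c then (1 : ℤ) else 0)
      = ∑ d ∈ n.divisors, if d ∣ c then ArithmeticFunction.moebius d else 0 := by
    intro c hc
    simp only [Nat.coprime_iff_gcd_eq_one]
    rw [← sum_moebius_dvd (n.gcd c), ← Finset.sum_filter]
    apply Finset.sum_congr _ (fun _ _ => rfl)
    ext d
    simp [Nat.dvd_gcd_iff, hn]
  rw [Finset.sum_congr rfl h1, Finset.sum_comm,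
    mul_comm (floorAF y), ArithmeticFunction.mul_apply,
    Nat.sum_divisorsAntidiagonal (fun i j => ArithmeticFunction.moebius i * floorAF y j)]
  apply Finset.sum_congr rfl
  intro d hd
  have hdn : d ∣ n := Nat.dvd_of_mem_divisors hd
  have hd0 : (d : ℚ) ≠ 0 := by
    have := Nat.pos_of_mem_divisors hd
    positivity
  rw [← Finset.sum_filter, Finset.sum_const, Nat.Ioc_filter_dvd_card_eq_div,
    ← Nat.floor_div_natCast, nsmul_eq_mul, mul_comm]
  simp only [floorAF, ArithmeticFunction.coe_mk]
  rw [Nat.cast_div hdn hd0, mul_div_assoc]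

lemma card_farey_filter (T : ℕ) (y : ℚ) (hy1 : y ≤ 1) :
    ((farey T).filter (fun ξ => 1 - y ≤ ξ ∧ ξ ≤ 1)).card
      = ∑ n ∈ Finset.Ioc 0 T,
        ((Finset.Ioc 0 ⌊y * n⌋₊).filter (fun c => Nat.Coprime n c)).card := by
  rw [← Finset.card_sigma]
  symm
  apply Finset.card_nbij (fun p => 1 - (p.2 : ℚ) / (p.1 : ℚ))
  · rintro ⟨n, c⟩ h
    simp only [Finset.mem_sigma, Finset.mem_Ioc, Finset.mem_filter, Finset.mem_coe] at h
    obtain ⟨⟨hn0, hnT⟩, ⟨hc0, hc⟩, hco⟩ := h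
    have hnq : (0 : ℚ) < n := by exact_mod_cast hn0
    have hcq : (0 : ℚ) < c := by exact_mod_cast hc0
    have hc' : (c : ℚ) ≤ y * n := (Nat.le_floor_iff' hc0.ne').mp hc
    have hdiv : (c : ℚ) / n ≤ y := (div_le_iff₀ hnq).mpr hc'
    have hpos : 0 < (c : ℚ) / n := by positivity
    simp only [Finset.mem_filter, mem_farey_iff, Finset.mem_coe]
    refine ⟨⟨by linarith, by linarith, ?_⟩, by linarith, by linarith⟩
    have e : (1 : ℚ) - c / n = (((n : ℤ) - c : ℤ) : ℚ) / ((n : ℤ) : ℚ) := by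
      push_cast; field_simp
    rw [e, ← Rat.divInt_eq_div]
    have := Rat.den_dvd ((n : ℤ) - c) n
    exact (Nat.le_of_dvd hn0 (by exact_mod_cast this)).trans hnT
  · rintro ⟨n, c⟩ h ⟨m, e⟩ h' heq
    simp only [Finset.mem_sigma, Finset.mem_Ioc, Finset.mem_filter, Finset.mem_coe] at h h'
    obtain ⟨⟨hn0, hnT⟩, ⟨hc0, hc⟩, hco⟩ := h
    obtain ⟨⟨hm0, hmT⟩, ⟨he0, he⟩, hme⟩ := h'
    simp only [sub_right_inj] at heq
    have := Rat.div_int_inj (a := (c : ℤ)) (b := n) (c := e) (d := m) (by exact_mod_cast hn0)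
      (by exact_mod_cast hm0) (by simpa using hco.symm) (by simpa using hme.symm)
      (by simpa using heq)
    obtain ⟨h1, h2⟩ := this
    have h1 : c = e := by exact_mod_cast h1
    have h2 : n = m := by exact_mod_cast h2
    subst h1 h2
    rfl
  · intro q hq
    simp only [Finset.mem_filter, mem_farey_iff, Finset.mem_coe] at hq
    obtain ⟨⟨h0, h1, hd⟩, hy, -⟩ := hq
    have hn0 : 0 ≤ q.num := Rat.num_nonneg.mpr h0
    have hlt : q.num < q.den := Rat.num_lt_denom_iff.mpr h1
    have hdp := q.den_pos
    have hdq : (0 : ℚ) < q.den := by exact_mod_cast hdp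
    have hqe := Rat.num_div_den q
    have hcz : ((q.den - q.num.natAbs : ℕ) : ℤ) = q.den - q.num := by omega
    have hcq : ((q.den - q.num.natAbs : ℕ) : ℚ) = q.den - q.num := by exact_mod_cast hcz
    refine ⟨⟨q.den, q.den - q.num.natAbs⟩, ?_, ?_⟩
    · simp only [Finset.mem_sigma, Finset.mem_Ioc, Finset.mem_filter, Finset.mem_coe]
      have hc0 : 0 < q.den - q.num.natAbs := by omega
      refine ⟨⟨hdp, hd⟩, ⟨hc0, ?_⟩, ?_⟩
      · rw [Nat.le_floor_iff' hc0.ne', hcq]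
        have : (q.num : ℚ) = q * q.den := (Rat.mul_den_eq_num q).symm
        rw [this]
        nlinarith
      · rw [Nat.coprime_self_sub_right (by omega)]
        exact q.reduced.symm
    · simp only
      rw [hcq, sub_div, hqe, div_self hdq.ne']
      ring

lemma key (T : ℕ) (y : ℚ) (hy1 : y ≤ 1) :
    (((farey T).filter (fun ξ => 1 - y ≤ ξ ∧ ξ ≤ 1)).card : ℤ)
      = ∑ d ∈ Finset.Icc 1 T, (⌊y * d⌋₊ : ℤ) * mertens (T / d) := by
  rw [card_farey_filter T y hy1]
  push_cast
  rw [Finset.sum_congr rfl (fun n hn => card_coprime_eq y n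
    (by have := (Finset.mem_Ioc.mp hn).1; omega)), ArithmeticFunction.sum_Ioc_mul_eq_sum_sum]
  rfl

lemma F_eq (T : ℕ) : (F T : ℤ) = ∑ d ∈ Finset.Icc 1 T, (d : ℤ) * mertens (T / d) := by
  have h := key T 1 le_rfl
  rw [Finset.filter_true_of_mem] at h
  · simpa [F] using h
  · intro q hq
    rw [mem_farey_iff] at hq
    exact ⟨by linarith [hq.1], hq.2.1.le⟩

/-- `C(T) - F(T)·G(T) = -∑_{a/b ∈ 𝓕(T) ∩ [0,1/2]} ∑_{d=1}^{T} {d·a²/b²}·M(⌊T/d⌋)`,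
where for a Farey fraction `q = a/b` in lowest terms `a²/b² = q²`. -/
theorem CT_sub_FG_eq (T : ℕ) (hT : 1 ≤ T) :
    (C T : ℝ) - (F T : ℝ) * G T
      = - ∑ q ∈ fareyHalf T, ∑ d ∈ Finset.Icc 1 T,
          Int.fract ((d : ℝ) * (q : ℝ) ^ 2) * (mertens (T / d) : ℝ) := by
  have hF : (F T : ℝ) = ∑ d ∈ Finset.Icc 1 T, (d : ℝ) * (mertens (T / d) : ℝ) := by
    exact_mod_cast congrArg (Int.cast : ℤ → ℝ) (F_eq T)
  unfold C G
  push_cast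
  rw [Finset.mul_sum, ← Finset.sum_sub_distrib, ← Finset.sum_neg_distrib]
  apply Finset.sum_congr rfl
  intro q hq
  simp only [fareyHalf, Finset.mem_filter, mem_farey_iff] at hq
  obtain ⟨⟨h0, h1, -⟩, -⟩ := hq
  have hk := congrArg (Int.cast : ℤ → ℝ) (key T (q ^ 2) (by nlinarith))
  push_cast at hk
  rw [hk, hF, Finset.sum_mul, ← Finset.sum_sub_distrib, ← Finset.sum_neg_distrib]
  apply Finset.sum_congr rfl
  intro d _
  have e : ((⌊q ^ 2 * (d : ℚ)⌋₊ : ℕ) : ℝ) = (⌊(d : ℝ) * (q : ℝ) ^ 2⌋ : ℝ) := by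
    have e1 : ((⌊q ^ 2 * (d : ℚ)⌋₊ : ℕ) : ℤ) = ⌊q ^ 2 * (d : ℚ)⌋ :=
      Int.natCast_floor_eq_floor (by positivity)
    have e2 : ⌊(((q ^ 2 * (d : ℚ)) : ℚ) : ℝ)⌋ = ⌊q ^ 2 * (d : ℚ)⌋ := Rat.floor_cast _
    push_cast at e2
    rw [mul_comm (d : ℝ), e2, ← e1]
    simp
  rw [e, Int.fract]
  ring
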